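/- For every N ≥ 1, β > 0, t ∈ [0,1] and integer k ≥ 1, the following chain of inequalities holds: E⟨R⁻(σ,τ)^k⟩_t ≤ E⟨R(σ,τ)^k⟩_t ≤ E⟨R(σ¹,σ²)^k⟩, where ⟨·⟩_t is the coupled Gibbs average and ⟨·⟩ is the Gibbs average of the original single SK system at inverse temperature β (so that E⟨R(σ,τ)^k⟩_1 = E⟨R(σ¹,σ²)^k⟩). Moreover, E⟨R(σ,τ)^k⟩_t is non-negative and non-decreasing in t. -/

import Mathlib

open MeasureTheory ProbabilityTheory Real Finset Filter

noncomputable section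

/-- Spin configurations: each of the `N` sites carries a `±1` spin, encoded by a `Bool`. -/
abbrev Config (N : ℕ) := Fin N → Bool

/-- The `±1` value of a spin. -/
def spin (b : Bool) : ℝ := if b then 1 else -1

/-- The value of the last spin `σ_N` (junk value `0` when `N = 0`). -/
def spinLast {N : ℕ} (σ : Config N) : ℝ :=
  if h : 0 < N then spin (σ ⟨N - 1, Nat.sub_lt h Nat.one_pos⟩) else 0

/-- The Gaussian disorder: i.i.d. standard Gaussians indexed by pairs `(i, j)`
(only the entries with `i < j` are used). -/
def gaussPi (N : ℕ) : Measure (Fin N × Fin N → ℝ) :=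
  Measure.pi fun _ => gaussianReal 0 1

instance (N : ℕ) : IsProbabilityMeasure (gaussPi N) := by
  unfold gaussPi; infer_instance

/-- Three independent copies `g, g', g''` of the disorder. -/
def disM3 (N : ℕ) :
    Measure ((Fin N × Fin N → ℝ) × (Fin N × Fin N → ℝ) × (Fin N × Fin N → ℝ)) :=
  (gaussPi N).prod ((gaussPi N).prod (gaussPi N))

/-- The SK Hamiltonian `H_{N,β}(σ) = (β/√N) ∑_{i<j} g_{ij} σ_i σ_j`. -/
def ham (N : ℕ) (β : ℝ) (g : Fin N × Fin N → ℝ) (σ : Config N) : ℝ :=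
  (β / Real.sqrt N) *
    ∑ p ∈ Finset.univ.filter (fun p : Fin N × Fin N => p.1 < p.2),
      g p * spin (σ p.1) * spin (σ p.2)

/-- The cavity Hamiltonian `H⁻_N(σ) = (β/√N) ∑_{i<j<N} g_{ij} σ_i σ_j` on the first
`N - 1` spins. -/
def hamCav (N : ℕ) (β : ℝ) (g : Fin N × Fin N → ℝ) (σ : Config N) : ℝ :=
  (β / Real.sqrt N) *
    ∑ p ∈ Finset.univ.filter
        (fun p : Fin N × Fin N => p.1 < p.2 ∧ (p.2 : ℕ) < N - 1),
      g p * spin (σ p.1) * spin (σ p.2)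

/-- The overlap `R(σ¹,σ²) = (1/N) ∑_{i ≤ N} σ_i¹ σ_i²`. -/
def ovlp (N : ℕ) (σ τ : Config N) : ℝ := (∑ i, spin (σ i) * spin (τ i)) / N

/-- The truncated overlap `R⁻(σ¹,σ²) = (1/N) ∑_{i ≤ N−1} σ_i¹ σ_i²`. -/
def ovlpm (N : ℕ) (σ τ : Config N) : ℝ :=
  (∑ i ∈ Finset.univ.filter (fun i : Fin N => (i : ℕ) < N - 1),
    spin (σ i) * spin (τ i)) / N

/-- The partition function `Z_N(β)`. -/
def partFun (N : ℕ) (β : ℝ) (g : Fin N × Fin N → ℝ) : ℝ :=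
  ∑ σ : Config N, Real.exp (ham N β g σ)

/-- The free energy `F_N(β) = ln Z_N(β)`. -/
def freeEnergy (N : ℕ) (β : ℝ) (g : Fin N × Fin N → ℝ) : ℝ :=
  Real.log (partFun N β g)

/-- Two-replica Gibbs average `⟨f⟩` for the single SK system. -/
def gibbs2 (N : ℕ) (β : ℝ) (g : Fin N × Fin N → ℝ)
    (f : Config N → Config N → ℝ) : ℝ :=
  (∑ σ : Config N, ∑ τ : Config N,
    f σ τ * Real.exp (ham N β g σ + ham N β g τ)) / (partFun N β g) ^ 2

/-- Disorder expectation of the two-replica Gibbs average. -/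
def Egibbs2 (N : ℕ) (β : ℝ) (f : Config N → Config N → ℝ) : ℝ :=
  ∫ g, gibbs2 N β g f ∂gaussPi N

/-- The interpolated Hamiltonian `√t · H_N + √(1−t) · H'_N`. -/
def hamT (N : ℕ) (β t : ℝ) (g g' : Fin N × Fin N → ℝ) (σ : Config N) : ℝ :=
  Real.sqrt t * ham N β g σ + Real.sqrt (1 - t) * ham N β g' σ

/-- The coupled Gibbs weight `exp(H¹_{N,t}(σ) + H²_{N,t}(τ))`. -/
def wT (N : ℕ) (β t : ℝ) (g g' g'' : Fin N × Fin N → ℝ)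
    (ρ : Config N × Config N) : ℝ :=
  Real.exp (hamT N β t g g' ρ.1 + hamT N β t g g'' ρ.2)

/-- The coupled Gibbs average `⟨f⟩_t` of a function of one pair `(σ, τ)`. -/
def gibbsT (N : ℕ) (β t : ℝ) (g g' g'' : Fin N × Fin N → ℝ)
    (f : Config N × Config N → ℝ) : ℝ :=
  (∑ ρ : Config N × Config N, f ρ * wT N β t g g' g'' ρ) /
    (∑ ρ : Config N × Config N, wT N β t g g' g'' ρ)

/-- The coupled Gibbs average `⟨f⟩_t` of a function of two pairs. -/
def gibbsT2 (N : ℕ) (β t : ℝ) (g g' g'' : Fin N × Fin N → ℝ)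
    (f : Config N × Config N → Config N × Config N → ℝ) : ℝ :=
  (∑ ρ₁ : Config N × Config N, ∑ ρ₂ : Config N × Config N,
    f ρ₁ ρ₂ * wT N β t g g' g'' ρ₁ * wT N β t g g' g'' ρ₂) /
    (∑ ρ : Config N × Config N, wT N β t g g' g'' ρ) ^ 2

/-- Disorder expectation `E⟨f⟩_t` (one pair). -/
def EgibbsT (N : ℕ) (β t : ℝ) (f : Config N × Config N → ℝ) : ℝ :=
  ∫ ω, gibbsT N β t ω.1 ω.2.1 ω.2.2 f ∂disM3 N

/-- Disorder expectation `E⟨f⟩_t` (two pairs). -/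
def EgibbsT2 (N : ℕ) (β t : ℝ)
    (f : Config N × Config N → Config N × Config N → ℝ) : ℝ :=
  ∫ ω, gibbsT2 N β t ω.1 ω.2.1 ω.2.2 f ∂disM3 N

/-- The `s`-dependent cavity field term
`(β/√N) σ_N ∑_{i<N} (√t g_{iN} + √(1−t) g'_{iN}) σ_i`. -/
def cavField (N : ℕ) (β t : ℝ) (g g' : Fin N × Fin N → ℝ) (σ : Config N) : ℝ :=
  if h : 0 < N then
    (β / Real.sqrt N) * spin (σ ⟨N - 1, Nat.sub_lt h Nat.one_pos⟩) *
      ∑ i ∈ Finset.univ.filter (fun i : Fin N => (i : ℕ) < N - 1),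
        (Real.sqrt t * g (i, ⟨N - 1, Nat.sub_lt h Nat.one_pos⟩) +
          Real.sqrt (1 - t) * g' (i, ⟨N - 1, Nat.sub_lt h Nat.one_pos⟩)) * spin (σ i)
  else 0

/-- The cavity-interpolated Hamiltonian `H^1_{N,t,s}` (resp. `H^2_{N,t,s}` with `g''`). -/
def hamTS (N : ℕ) (β t s : ℝ) (g g' : Fin N × Fin N → ℝ) (σ : Config N) : ℝ :=
  Real.sqrt t * hamCav N β g σ + Real.sqrt (1 - t) * hamCav N β g' σ +
    Real.sqrt s * cavField N β t g g' σ

/-- The coupled cavity Gibbs weight `exp(H¹_{N,t,s}(σ) + H²_{N,t,s}(τ))`. -/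
def wTS (N : ℕ) (β t s : ℝ) (g g' g'' : Fin N × Fin N → ℝ)
    (ρ : Config N × Config N) : ℝ :=
  Real.exp (hamTS N β t s g g' ρ.1 + hamTS N β t s g g'' ρ.2)

/-- The coupled cavity Gibbs average `⟨f⟩_{t,s}` of a function of one pair. -/
def gibbsTS1 (N : ℕ) (β t s : ℝ) (g g' g'' : Fin N × Fin N → ℝ)
    (f : Config N × Config N → ℝ) : ℝ :=
  (∑ ρ : Config N × Config N, f ρ * wTS N β t s g g' g'' ρ) /
    (∑ ρ : Config N × Config N, wTS N β t s g g' g'' ρ)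

/-- The coupled cavity Gibbs average `⟨f⟩_{t,s}` of a function of two pairs. -/
def gibbsTS2 (N : ℕ) (β t s : ℝ) (g g' g'' : Fin N × Fin N → ℝ)
    (f : Config N × Config N → Config N × Config N → ℝ) : ℝ :=
  (∑ ρ₁ : Config N × Config N, ∑ ρ₂ : Config N × Config N,
    f ρ₁ ρ₂ * wTS N β t s g g' g'' ρ₁ * wTS N β t s g g' g'' ρ₂) /
    (∑ ρ : Config N × Config N, wTS N β t s g g' g'' ρ) ^ 2

/-- The coupled cavity Gibbs average `⟨f⟩_{t,s}` of a function of `n` pairs. -/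
def gibbsTSn (N : ℕ) (β t s : ℝ) (g g' g'' : Fin N × Fin N → ℝ) {n : ℕ}
    (f : (Fin n → Config N × Config N) → ℝ) : ℝ :=
  (∑ ρ : Fin n → Config N × Config N, f ρ * ∏ l, wTS N β t s g g' g'' (ρ l)) /
    (∑ ρ₀ : Config N × Config N, wTS N β t s g g' g'' ρ₀) ^ n

/-- Disorder expectation `E⟨f⟩_{t,s}` (one pair). -/
def EgibbsTS1 (N : ℕ) (β t s : ℝ) (f : Config N × Config N → ℝ) : ℝ :=
  ∫ ω, gibbsTS1 N β t s ω.1 ω.2.1 ω.2.2 f ∂disM3 N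

/-- Disorder expectation `E⟨f⟩_{t,s}` (two pairs). -/
def EgibbsTS2 (N : ℕ) (β t s : ℝ)
    (f : Config N × Config N → Config N × Config N → ℝ) : ℝ :=
  ∫ ω, gibbsTS2 N β t s ω.1 ω.2.1 ω.2.2 f ∂disM3 N

/-- Disorder expectation `E⟨f⟩_{t,s}` (`n` pairs). -/
def EgibbsTSn (N : ℕ) (β t s : ℝ) {n : ℕ}
    (f : (Fin n → Config N × Config N) → ℝ) : ℝ :=
  ∫ ω, gibbsTSn N β t s ω.1 ω.2.1 ω.2.2 f ∂disM3 N

/-- The covariance kernel `U(ρ, ρ')` of the `s`-part of the coupled cavity Hamiltonians. -/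
def Ufun (N : ℕ) (β t : ℝ) (ρ ρ' : Config N × Config N) : ℝ :=
  β ^ 2 / 2 * (spinLast ρ.1 * spinLast ρ'.1 * ovlpm N ρ.1 ρ'.1 +
      spinLast ρ.2 * spinLast ρ'.2 * ovlpm N ρ.2 ρ'.2) +
    β ^ 2 * t / 2 * (spinLast ρ.1 * spinLast ρ'.2 * ovlpm N ρ.1 ρ'.2 +
      spinLast ρ.2 * spinLast ρ'.1 * ovlpm N ρ.2 ρ'.1)

/-- `ν(β) = −(1/2)·ln(1 − β²) − β²/2`. -/
def nuSK (b : ℝ) : ℝ := -(1 / 2) * Real.log (1 - b ^ 2) - b ^ 2 / 2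

/-- The characteristic function of the standard Gaussian measure on `ι → ℝ`. -/
theorem charFunDual_pi_gaussianReal {ι : Type*} [Fintype ι] [DecidableEq ι]
    (L : StrongDual ℝ (ι → ℝ)) :
    charFunDual (Measure.pi fun _ : ι => gaussianReal 0 1) L =
      Complex.exp (-(∑ i, ((L (Pi.single i 1) : ℝ) : ℂ) ^ 2) / 2) := by
  have hc (i : ι) : charFunDual (gaussianReal 0 1)
      (L.comp (ContinuousLinearMap.single ℝ (fun _ : ι => ℝ) i)) =
      Complex.exp (-((L (Pi.single i 1) : ℝ) : ℂ) ^ 2 / 2) := by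
    have hM : L.comp (ContinuousLinearMap.single ℝ (fun _ : ι => ℝ) i) =
        L (Pi.single i 1) • ContinuousLinearMap.id ℝ ℝ := by
      ext
      simp
    rw [hM, ← charFun_map_eq_charFunDual_smul, ContinuousLinearMap.coe_id', Measure.map_id,
      charFun_gaussianReal]
    congr 1
    push_cast
    ring
  rw [charFunDual_pi]
  simp_rw [hc, ← Complex.exp_sum]
  congr 1
  rw [← Finset.sum_neg_distrib, Finset.sum_div]

/-- Rotation invariance of the standard Gaussian measure: if `a² + b² = c²`, then `a X + b Y` and
`c X` have the same law for independent standard Gaussian vectors `X` and `Y`. -/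
theorem map_add_smul_pi_gaussianReal {ι : Type*} [Fintype ι] {a b c : ℝ}
    (h : a ^ 2 + b ^ 2 = c ^ 2) :
    Measure.map (fun p : (ι → ℝ) × (ι → ℝ) => a • p.1 + b • p.2)
        ((Measure.pi fun _ => gaussianReal 0 1).prod (Measure.pi fun _ => gaussianReal 0 1)) =
      Measure.map (fun x : ι → ℝ => c • x) (Measure.pi fun _ => gaussianReal 0 1) := by
  classical
  let A : (ι → ℝ) × (ι → ℝ) →L[ℝ] (ι → ℝ) :=
    a • ContinuousLinearMap.fst ℝ _ _ + b • ContinuousLinearMap.snd ℝ _ _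
  let C : (ι → ℝ) →L[ℝ] (ι → ℝ) := c • ContinuousLinearMap.id ℝ _
  have hA : (fun p : (ι → ℝ) × (ι → ℝ) => a • p.1 + b • p.2) = A := by ext; simp [A]
  have hC : (fun x : ι → ℝ => c • x) = C := by ext; simp [C]
  rw [hA, hC]
  refine Measure.ext_of_charFunDual (funext fun L => ?_)
  rw [charFunDual_map, charFunDual_map, charFunDual_prod]
  simp only [charFunDual_pi_gaussianReal, ← Complex.exp_add]
  congr 1
  have hc : (c : ℂ) ^ 2 = a ^ 2 + b ^ 2 := by exact_mod_cast h.symm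
  simp only [A, C, ContinuousLinearMap.comp_apply, ContinuousLinearMap.inl_apply,
    ContinuousLinearMap.inr_apply, _root_.add_apply, _root_.smul_apply,
    ContinuousLinearMap.coe_fst', ContinuousLinearMap.coe_snd', ContinuousLinearMap.id_apply,
    smul_zero, add_zero, zero_add, map_smul, smul_eq_mul, Complex.ofReal_mul, mul_pow,
    ← Finset.mul_sum, hc]
  ring

/-- The Gaussian noise operator: `gaussNoise t f x` is the average of `f (√t x + √(1 - t) Y)` over a
standard Gaussian vector `Y`. -/
def gaussNoise {ι : Type*} [Fintype ι] (t : ℝ) (f : (ι → ℝ) → ℝ) (x : ι → ℝ) : ℝ :=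
  ∫ y, f (√t • x + √(1 - t) • y) ∂Measure.pi fun _ : ι => gaussianReal 0 1

section gaussNoise

variable {ι : Type*} [Fintype ι] {f : (ι → ℝ) → ℝ}

theorem measurable_gaussNoise (hf : Measurable f) (t : ℝ) : Measurable (gaussNoise t f) := by
  have h : StronglyMeasurable (Function.uncurry fun x y : ι → ℝ =>
      f (√t • x + √(1 - t) • y)) :=
    Measurable.stronglyMeasurable (hf.comp (by fun_prop))
  exact h.integral_prod_right.measurable

theorem abs_gaussNoise_le_one (hb : ∀ x, |f x| ≤ 1) (t : ℝ) (x : ι → ℝ) :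
    |gaussNoise t f x| ≤ 1 := by
  have h := norm_integral_le_of_norm_le_const (μ := Measure.pi fun _ : ι => gaussianReal 0 1)
    (f := fun y => f (√t • x + √(1 - t) • y)) (C := 1)
    (Eventually.of_forall fun y => hb _)
  simpa [gaussNoise] using h

theorem integrable_of_abs_le_one {Ω : Type*} [MeasurableSpace Ω] {μ : Measure Ω}
    [IsFiniteMeasure μ] {g : Ω → ℝ} (hg : Measurable g) (hb : ∀ x, |g x| ≤ 1) :
    Integrable g μ :=
  Integrable.of_bound hg.aestronglyMeasurable 1 (Eventually.of_forall hb)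

theorem abs_sq_le_one_of_abs_le_one {a : ℝ} (ha : |a| ≤ 1) : |a ^ 2| ≤ 1 := by
  rw [abs_pow]
  exact pow_le_one₀ (abs_nonneg a) ha

/-- Semigroup property of the Gaussian noise operators. -/
theorem gaussNoise_gaussNoise (hf : Measurable f) (hb : ∀ x, |f x| ≤ 1) {s t : ℝ}
    (hs : s ∈ Set.Icc (0 : ℝ) 1) (ht : t ∈ Set.Icc (0 : ℝ) 1) :
    gaussNoise s (gaussNoise t f) = gaussNoise (s * t) f := by
  funext x
  have hst : s * t ≤ 1 := mul_le_one₀ hs.2 ht.1 ht.2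
  have hsq : (√t * √(1 - s)) ^ 2 + √(1 - t) ^ 2 = √(1 - s * t) ^ 2 := by
    rw [mul_pow, sq_sqrt ht.1, sq_sqrt (sub_nonneg.2 hs.2), sq_sqrt (sub_nonneg.2 ht.2),
      sq_sqrt (sub_nonneg.2 hst)]
    ring
  have hF : Measurable fun z : ι → ℝ => f (√(s * t) • x + z) := hf.comp (by fun_prop)
  have hmap := congrArg (fun μ => ∫ z, f (√(s * t) • x + z) ∂μ)
    (map_add_smul_pi_gaussianReal (ι := ι) hsq)
  simp only at hmap
  rw [integral_map (by fun_prop) hF.aestronglyMeasurable,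
    integral_map (by fun_prop) hF.aestronglyMeasurable, integral_prod] at hmap
  · simp only [gaussNoise]
    rw [← hmap]
    congr! 5 with y z
    rw [sqrt_mul hs.1]
    simp only [smul_add, smul_smul, mul_comm (√s), add_assoc]
  · exact integrable_of_abs_le_one (hF.comp (by fun_prop)) fun _ => hb _

theorem integral_sq_gaussNoise_le (hf : Measurable f) (hb : ∀ x, |f x| ≤ 1) {s : ℝ}
    (hs : s ∈ Set.Icc (0 : ℝ) 1) :
    ∫ x, gaussNoise s f x ^ 2 ∂(Measure.pi fun _ : ι => gaussianReal 0 1) ≤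
      ∫ x, f x ^ 2 ∂(Measure.pi fun _ : ι => gaussianReal 0 1) := by
  have hsq : √s ^ 2 + √(1 - s) ^ 2 = 1 ^ 2 := by
    rw [sq_sqrt hs.1, sq_sqrt (sub_nonneg.2 hs.2)]
    ring
  have hf2 : Measurable fun x => f x ^ 2 := hf.pow_const 2
  have hb2 (x) : |f x ^ 2| ≤ 1 := abs_sq_le_one_of_abs_le_one (hb x)
  have hmap := congrArg (fun μ => ∫ z, f z ^ 2 ∂μ) (map_add_smul_pi_gaussianReal (ι := ι) hsq)
  have hi : Integrable (fun p : (ι → ℝ) × (ι → ℝ) => f (√s • p.1 + √(1 - s) • p.2) ^ 2)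
      ((Measure.pi fun _ => gaussianReal 0 1).prod (Measure.pi fun _ => gaussianReal 0 1)) :=
    integrable_of_abs_le_one (hf2.comp (by fun_prop)) fun _ => hb2 _
  simp only [one_smul, Measure.map_id'] at hmap
  rw [integral_map (by fun_prop) hf2.aestronglyMeasurable, integral_prod _ hi] at hmap
  rw [← hmap]
  refine integral_mono (integrable_of_abs_le_one ((measurable_gaussNoise hf s).pow_const 2)
    fun x => abs_sq_le_one_of_abs_le_one (abs_gaussNoise_le_one hb s x)) hi.integral_prod_left
    fun x => ?_
  have hm : Measurable fun y : ι → ℝ => f (√s • x + √(1 - s) • y) := hf.comp (by fun_prop)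
  exact (even_two.convexOn_pow (𝕜 := ℝ)).map_integral_le (by fun_prop) isClosed_univ (by simp)
    (integrable_of_abs_le_one hm fun _ => hb _)
    (integrable_of_abs_le_one (hm.pow_const 2) fun _ => hb2 _)

theorem integral_sq_gaussNoise_mono (hf : Measurable f) (hb : ∀ x, |f x| ≤ 1) {t₁ t₂ : ℝ}
    (h₁ : 0 ≤ t₁) (h₁₂ : t₁ ≤ t₂) (h₂ : t₂ ≤ 1) :
    ∫ x, gaussNoise t₁ f x ^ 2 ∂(Measure.pi fun _ : ι => gaussianReal 0 1) ≤
      ∫ x, gaussNoise t₂ f x ^ 2 ∂(Measure.pi fun _ : ι => gaussianReal 0 1) := by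
  rcases (h₁.trans h₁₂).eq_or_lt with h0 | h0
  · rw [le_antisymm h₁₂ (h0 ▸ h₁)]
  · have hs : t₁ / t₂ ∈ Set.Icc (0 : ℝ) 1 := ⟨div_nonneg h₁ h0.le, div_le_one_of_le₀ h₁₂ h0.le⟩
    have hsg := gaussNoise_gaussNoise hf hb hs ⟨h0.le, h₂⟩
    rw [div_mul_cancel₀ _ h0.ne'] at hsg
    rw [← hsg]
    exact integral_sq_gaussNoise_le (measurable_gaussNoise hf t₂) (abs_gaussNoise_le_one hb t₂) hs

/-- Two copies of `f` evaluated at Gaussian vectors with correlation `t` are conditionally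
independent given the common part. -/
theorem integral_correlated_mul_eq_integral_sq_gaussNoise (hf : Measurable f)
    (hb : ∀ x, |f x| ≤ 1) (t : ℝ) :
    ∫ ω : (ι → ℝ) × (ι → ℝ) × (ι → ℝ),
        f (√t • ω.1 + √(1 - t) • ω.2.1) * f (√t • ω.1 + √(1 - t) • ω.2.2)
        ∂((Measure.pi fun _ : ι => gaussianReal 0 1).prod
          ((Measure.pi fun _ : ι => gaussianReal 0 1).prod
            (Measure.pi fun _ : ι => gaussianReal 0 1))) =
      ∫ x, gaussNoise t f x ^ 2 ∂(Measure.pi fun _ : ι => gaussianReal 0 1) := by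
  rw [integral_prod]
  · refine integral_congr_ae (Eventually.of_forall fun x => ?_)
    simp only [gaussNoise]
    rw [integral_prod_mul (fun y : ι → ℝ => f (√t • x + √(1 - t) • y))
      (fun y : ι → ℝ => f (√t • x + √(1 - t) • y)), sq]
  · refine integrable_of_abs_le_one
      ((hf.comp (by fun_prop)).mul (hf.comp (by fun_prop))) fun ω => ?_
    rw [abs_mul]
    exact mul_le_one₀ (hb _) (abs_nonneg _) (hb _)

end gaussNoise

theorem abs_spin (b : Bool) : |spin b| = 1 := by
  cases b <;> simp [spin]

theorem ham_add_smul (N : ℕ) (β a b : ℝ) (g g' : Fin N × Fin N → ℝ) (σ : Config N) :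
    ham N β (a • g + b • g') σ = a * ham N β g σ + b * ham N β g' σ := by
  simp only [ham, Pi.add_apply, Pi.smul_apply, smul_eq_mul, add_mul, Finset.sum_add_distrib,
    mul_assoc, ← Finset.mul_sum]
  ring

theorem partFun_pos (N : ℕ) (β : ℝ) (g : Fin N × Fin N → ℝ) : 0 < partFun N β g :=
  Finset.sum_pos (fun _ _ => exp_pos _) Finset.univ_nonempty

/-- The Gibbs average of the product of the spins `σ_{I 0} ⋯ σ_{I (k - 1)}`. -/
def spinMoment (N : ℕ) (β : ℝ) {k : ℕ} (I : Fin k → Fin N) (g : Fin N × Fin N → ℝ) : ℝ :=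
  (∑ σ : Config N, (∏ j, spin (σ (I j))) * Real.exp (ham N β g σ)) / partFun N β g

theorem measurable_spinMoment (N : ℕ) (β : ℝ) {k : ℕ} (I : Fin k → Fin N) :
    Measurable (spinMoment N β I) := by
  unfold spinMoment partFun ham
  fun_prop

theorem abs_spinMoment_le_one (N : ℕ) (β : ℝ) {k : ℕ} (I : Fin k → Fin N)
    (g : Fin N × Fin N → ℝ) : |spinMoment N β I g| ≤ 1 := by
  rw [spinMoment, abs_div, abs_of_pos (partFun_pos N β g)]
  refine div_le_one_of_le₀ ((Finset.abs_sum_le_sum_abs _ _).trans_eq ?_) (partFun_pos N β g).le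
  simp [partFun, abs_mul, Finset.abs_prod, abs_spin]

/-- The coupled Gibbs average of a moment of a partial overlap, as a sum of products of spin
moments of the two systems. -/
theorem gibbsT_partial_overlap_pow (N : ℕ) (β t : ℝ) (k : ℕ) (s : Finset (Fin N))
    (g g' g'' : Fin N × Fin N → ℝ) :
    gibbsT N β t g g' g'' (fun ρ => ((∑ i ∈ s, spin (ρ.1 i) * spin (ρ.2 i)) / N) ^ k) =
      ∑ I ∈ Fintype.piFinset fun _ : Fin k => s,
        spinMoment N β I (√t • g + √(1 - t) • g') *
          spinMoment N β I (√t • g + √(1 - t) • g'') / (N : ℝ) ^ k := by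
  have hw (ρ : Config N × Config N) : wT N β t g g' g'' ρ =
      Real.exp (ham N β (√t • g + √(1 - t) • g') ρ.1) *
        Real.exp (ham N β (√t • g + √(1 - t) • g'') ρ.2) := by
    rw [wT, Real.exp_add, hamT, hamT, ham_add_smul, ham_add_smul]
  have hden : ∑ ρ : Config N × Config N, wT N β t g g' g'' ρ =
      partFun N β (√t • g + √(1 - t) • g') * partFun N β (√t • g + √(1 - t) • g'') := by
    simp only [hw, partFun, Fintype.sum_prod_type, Finset.sum_mul_sum]
  have hnum (I : Fin k → Fin N) : spinMoment N β I (√t • g + √(1 - t) • g') *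
        spinMoment N β I (√t • g + √(1 - t) • g'') / (N : ℝ) ^ k =
      (∑ ρ : Config N × Config N, (∏ j, spin (ρ.1 (I j)) * spin (ρ.2 (I j))) / (N : ℝ) ^ k *
        wT N β t g g' g'' ρ) / ∑ ρ : Config N × Config N, wT N β t g g' g'' ρ := by
    rw [hden, spinMoment, spinMoment, div_mul_div_comm, div_right_comm, Finset.sum_mul_sum,
      Finset.sum_div, Fintype.sum_prod_type]
    simp only [hw, Finset.sum_div, Finset.prod_mul_distrib]
    refine Finset.sum_congr rfl fun σ _ => Finset.sum_congr rfl fun τ _ => ?_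
    ring
  simp only [hnum, gibbsT, ← Finset.sum_div]
  rw [Finset.sum_comm]
  simp only [div_pow _ (N : ℝ), Finset.sum_pow', ← Finset.sum_div, ← Finset.sum_mul]

theorem EgibbsT_partial_overlap_pow (N : ℕ) (β t : ℝ) (k : ℕ) (s : Finset (Fin N)) :
    EgibbsT N β t (fun ρ => ((∑ i ∈ s, spin (ρ.1 i) * spin (ρ.2 i)) / N) ^ k) =
      ∑ I ∈ Fintype.piFinset fun _ : Fin k => s,
        (∫ g, gaussNoise t (spinMoment N β I) g ^ 2 ∂gaussPi N) / (N : ℝ) ^ k := by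
  simp only [EgibbsT, gibbsT_partial_overlap_pow]
  rw [integral_finsetSum]
  · refine Finset.sum_congr rfl fun I _ => ?_
    rw [integral_div]
    congr 1
    exact integral_correlated_mul_eq_integral_sq_gaussNoise (measurable_spinMoment N β I)
      (abs_spinMoment_le_one N β I) t
  · intro I _
    have : IsProbabilityMeasure (disM3 N) := by unfold disM3; infer_instance
    have hm := measurable_spinMoment N β I
    refine Integrable.div_const (integrable_of_abs_le_one
      ((hm.comp (by fun_prop)).mul (hm.comp (by fun_prop))) fun ω => ?_) _
    rw [Pi.mul_apply, abs_mul]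
    exact mul_le_one₀ (abs_spinMoment_le_one N β I _) (abs_nonneg _)
      (abs_spinMoment_le_one N β I _)

theorem EgibbsT_one (N : ℕ) (β : ℝ) (f : Config N → Config N → ℝ) :
    EgibbsT N β 1 (fun ρ => f ρ.1 ρ.2) = Egibbs2 N β f := by
  have h (g g' g'' : Fin N × Fin N → ℝ) :
      gibbsT N β 1 g g' g'' (fun ρ => f ρ.1 ρ.2) = gibbs2 N β g f := by
    simp only [gibbsT, gibbs2, wT, hamT, sqrt_one, sub_self, sqrt_zero, one_mul, zero_mul,
      add_zero, Fintype.sum_prod_type, partFun, sq, Finset.sum_mul_sum, Real.exp_add]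
  simp only [EgibbsT, Egibbs2, h, disM3]
  rw [integral_fun_fst (fun g => gibbs2 N β g f)]
  simp

/-- overlap moment comparisons
`E⟨R⁻(σ,τ)^k⟩_t ≤ E⟨R(σ,τ)^k⟩_t ≤ E⟨R(σ¹,σ²)^k⟩`, with
`E⟨R(σ,τ)^k⟩_1 = E⟨R(σ¹,σ²)^k⟩`, and `t ↦ E⟨R(σ,τ)^k⟩_t` non-negative and
non-decreasing. -/
theorem sk_overlap_moment_chain (N : ℕ) (hN : 1 ≤ N) (β : ℝ) (hβ : 0 < β)
    (k : ℕ) (hk : 1 ≤ k) :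
    (∀ t ∈ Set.Icc (0 : ℝ) 1,
      EgibbsT N β t (fun ρ => ovlpm N ρ.1 ρ.2 ^ k) ≤
          EgibbsT N β t (fun ρ => ovlp N ρ.1 ρ.2 ^ k) ∧
        EgibbsT N β t (fun ρ => ovlp N ρ.1 ρ.2 ^ k) ≤
          Egibbs2 N β (fun σ τ => ovlp N σ τ ^ k) ∧
        0 ≤ EgibbsT N β t (fun ρ => ovlp N ρ.1 ρ.2 ^ k)) ∧
    EgibbsT N β 1 (fun ρ => ovlp N ρ.1 ρ.2 ^ k) =
      Egibbs2 N β (fun σ τ => ovlp N σ τ ^ k) ∧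
    (∀ t₁ ∈ Set.Icc (0 : ℝ) 1, ∀ t₂ ∈ Set.Icc (0 : ℝ) 1, t₁ ≤ t₂ →
      EgibbsT N β t₁ (fun ρ => ovlp N ρ.1 ρ.2 ^ k) ≤
        EgibbsT N β t₂ (fun ρ => ovlp N ρ.1 ρ.2 ^ k)) := by
  have hR (t : ℝ) : EgibbsT N β t (fun ρ => ovlp N ρ.1 ρ.2 ^ k) = _ :=
    EgibbsT_partial_overlap_pow N β t k Finset.univ
  have hRm (t : ℝ) : EgibbsT N β t (fun ρ => ovlpm N ρ.1 ρ.2 ^ k) = _ :=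
    EgibbsT_partial_overlap_pow N β t k
      (Finset.univ.filter fun i : Fin N => (i : ℕ) < N - 1)
  have hone := EgibbsT_one N β (fun σ τ => ovlp N σ τ ^ k)
  have hterm (t : ℝ) (I : Fin k → Fin N) :
      0 ≤ (∫ g, gaussNoise t (spinMoment N β I) g ^ 2 ∂gaussPi N) / (N : ℝ) ^ k :=
    div_nonneg (integral_nonneg fun _ => sq_nonneg _) (by positivity)
  have hmono : ∀ t₁ ∈ Set.Icc (0 : ℝ) 1, ∀ t₂ ∈ Set.Icc (0 : ℝ) 1, t₁ ≤ t₂ →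
      EgibbsT N β t₁ (fun ρ => ovlp N ρ.1 ρ.2 ^ k) ≤
        EgibbsT N β t₂ (fun ρ => ovlp N ρ.1 ρ.2 ^ k) := by
    intro t₁ h₁ t₂ h₂ h₁₂
    rw [hR, hR]
    refine Finset.sum_le_sum fun I _ => div_le_div_of_nonneg_right ?_ (by positivity)
    exact integral_sq_gaussNoise_mono (measurable_spinMoment N β I)
      (abs_spinMoment_le_one N β I) h₁.1 h₁₂ h₂.2
  refine ⟨fun t ht => ⟨?_, ?_, ?_⟩, hone, hmono⟩
  · rw [hR, hRm]
    exact Finset.sum_le_sum_of_subset_of_nonneg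
      (Fintype.piFinset_subset _ _ fun _ => Finset.filter_subset _ _) fun I _ _ => hterm t I
  · rw [← hone]
    exact hmono t ht 1 ⟨zero_le_one, le_rfl⟩ ht.2
  · rw [hR]
    exact Finset.sum_nonneg fun I _ => hterm t I

end
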